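/- Let Σ = {0,1,2,3,4} be a five-letter alphabet. For every sequence v_1, v_2, v_3, … of letters of Σ and every strictly increasing sequence of positive integers p_1 < p_2 < p_3 < … such that p_{i+1} − p_i ≥ 3 for all i ≥ 1, there exists an infinite square-free word u = u_1 u_2 u_3 … over Σ such that u_{p_i} = v_i for all i ≥ 1. (In other words, d({0,1,2,3,4}) ≤ 3.) -/

import Mathlib

/-- An infinite word `u` (positions indexed from 1) is square-free: it has no factor
`u_i … u_{i+n-1} u_{i+n} … u_{i+2n-1}` with the two halves equal. -/
def SqFreeSeq {α : Type*} (u : ℕ → α) : Prop :=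
  ∀ i n : ℕ, 1 ≤ i → 1 ≤ n → ∃ k, k < n ∧ u (i + k) ≠ u (i + n + k)

def force {α : Type} (n : ℕ) (f : ℕ → α) : α := Nat.casesOn n (f 0) (fun m => f (Nat.succ m))
def dg (m W : ℕ) : ℕ := Nat.mod (Nat.div W m) 8
def eqN (m k W : ℕ) : Bool := Nat.beq (dg m W) (dg k W)
def bitN (m W : ℕ) : ℕ := Nat.div (Nat.pow 64 (dg m W)) 64
def kp (m W : ℕ) : ℕ :=
  cond (Nat.beq (Nat.mod W m) (Nat.mod (Nat.div W (Nat.mul m 8)) m)) (bitN m W) 0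
def KN (W : ℕ) : ℕ :=
  Nat.lor (kp 1 W) (Nat.lor (kp 8 W) (Nat.lor (kp 64 W) (Nat.lor (kp 512 W) (kp 4096 W))))
def b1 (W : ℕ) : ℕ := cond (eqN 8 512 W) (cond (eqN 512 32768 W) (cond (eqN 1 4096 W) (bitN 8 W) 0) 0) 0
def b2 (W : ℕ) : ℕ := cond (eqN 8 4096 W) (cond (eqN 8 262144 W) (cond (eqN 1 32768 W) (cond (eqN 64 2097152 W) (bitN 8 W) 0) 0) 0) 0
def b3 (W : ℕ) : ℕ := cond (eqN 64 4096 W) (cond (eqN 64 2097152 W) (cond (eqN 1 32768 W) (cond (eqN 8 262144 W) (bitN 64 W) 0) 0) 0) 0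
def BN (W : ℕ) : ℕ := Nat.lor (b1 W) (Nat.lor (b2 W) (b3 W))
def gN (W : ℕ) : ℕ := Nat.sub 17043521 (Nat.lor (KN W) (BN W))
def frN (k p : ℕ) : Bool := Nat.beq (Nat.land k p) 0
def stp (k p x W : ℕ) (f : ℕ → ℕ) : ℕ :=
  cond (frN k p) (force (Nat.add (Nat.mul 8 W) x) f) 0
def sumN (k W : ℕ) (f : ℕ → ℕ) : ℕ :=
  Nat.add (stp k 1 1 W f) (Nat.add (stp k 64 2 W f) (Nat.add (stp k 4096 3 W f)
   (Nat.add (stp k 262144 4 W f) (stp k 16777216 5 W f))))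
def v2 (W : ℕ) : ℕ := force (KN W) fun k => sumN k W gN
def big (V : ℕ) : Bool := Nat.ble 8 (Nat.mod V 64) && (Nat.ble 8 (Nat.mod (Nat.div V 64) 64) &&
  (Nat.ble 8 (Nat.mod (Nat.div V 4096) 64) && (Nat.ble 8 (Nat.mod (Nat.div V 262144) 64) && 
   (Nat.ble 8 (Nat.mod (Nat.div V 16777216) 64)))))
def QN (k W : ℕ) : Bool := Nat.ble 3 (Nat.mod (gN W) 63) && force (sumN k W v2) big
def chkN : ℕ → ℕ → ℕ → Bool → Bool
  | 0, W, _, t => t || QN (KN W) W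
  | n+1, W, c, t => force (KN W) fun k => (t || QN k W) && force (BN W) fun b =>
    (List.all [(1,1),(64,2),(4096,3),(262144,4),(16777216,5)] fun y =>
      !(Nat.ble y.2 c) || (!(frN k y.1) || (force (Nat.add (Nat.mul 8 W) y.2) fun V =>
        chkN n V (cond (Nat.beq y.2 c) (Nat.succ c) c) (!(frN b y.1)))))

abbrev Wd := List (Fin 5)

def Sq (p : ℕ) (w : Wd) : Prop := 2 * p ≤ w.length ∧ w.take p = (w.drop p).take p

def Sh (w : Wd) : Prop := ∀ p, 1 ≤ p → p ≤ 5 → ¬ Sq p w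

def Ban : Wd → Prop
  | [] => False
  | b :: w =>
    (w[1]? = some b ∧ w[3]? = some b ∧ w[5]? = some b ∧ w[0]? = w[4]?) ∨
    (w[1]? = some b ∧ w[4]? = some b ∧ w[6]? = some b ∧ w[0]? = w[5]? ∧ w[2]? = w[7]?) ∨
    (w[2]? = some b ∧ w[4]? = some b ∧ w[7]? = some b ∧ w[0]? = w[5]? ∧ w[1]? = w[6]?)

def enc : Wd → ℕ
  | [] => 0
  | x :: w => 8 * enc w + (x.val + 1)

def MM (s : Fin 5 → Prop) [DecidablePred s] : ℕ :=
  (decide (s 0)).toNat + 64 * (decide (s 1)).toNat + 4096 * (decide (s 2)).toNat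
    + 262144 * (decide (s 3)).toNat + 16777216 * (decide (s 4)).toNat

theorem MM_congr {s t : Fin 5 → Prop} [DecidablePred s] [DecidablePred t] (h : ∀ b, s b ↔ t b) :
    MM s = MM t := by
  unfold MM
  simp only [h]

theorem MM_lor (s t : Fin 5 → Prop) [DecidablePred s] [DecidablePred t] :
    Nat.lor (MM s) (MM t) = MM (fun b => s b ∨ t b) := by
  unfold MM
  simp only [Bool.decide_or]
  generalize decide (s 0) = a0
  generalize decide (s 1) = a1
  generalize decide (s 2) = a2
  generalize decide (s 3) = a3
  generalize decide (s 4) = a4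
  generalize decide (t 0) = c0
  generalize decide (t 1) = c1
  generalize decide (t 2) = c2
  generalize decide (t 3) = c3
  generalize decide (t 4) = c4
  revert a0 a1 a2 a3 a4 c0 c1 c2 c3 c4
  decide +kernel

theorem MM_sub (s : Fin 5 → Prop) [DecidablePred s] :
    Nat.sub 17043521 (MM s) = MM (fun b => ¬ s b) := by
  unfold MM
  simp only [decide_not]
  generalize decide (s 0) = a0
  generalize decide (s 1) = a1
  generalize decide (s 2) = a2
  generalize decide (s 3) = a3
  generalize decide (s 4) = a4
  revert a0 a1 a2 a3 a4
  decide +kernel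

theorem MM_mod (s : Fin 5 → Prop) [DecidablePred s] :
    Nat.mod (MM s) 63 = (Finset.univ.filter s).card := by
  rw [Finset.card_filter]
  simp only [Fin.sum_univ_five]
  have : ∀ b, (if s b then 1 else 0) = (decide (s b)).toNat := by
    intro b; by_cases h : s b <;> simp [h]
  simp only [this]
  unfold MM
  generalize decide (s 0) = a0
  generalize decide (s 1) = a1
  generalize decide (s 2) = a2
  generalize decide (s 3) = a3
  generalize decide (s 4) = a4
  revert a0 a1 a2 a3 a4
  decide +kernel

theorem MM_fr (s : Fin 5 → Prop) [DecidablePred s] (x : Fin 5) :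
    frN (MM s) (64 ^ x.val) = decide (¬ s x) := by
  unfold MM frN
  simp only [decide_not]
  have : (decide (s x)) = (![decide (s 0), decide (s 1), decide (s 2), decide (s 3), decide (s 4)]) x := by
    fin_cases x <;> rfl
  rw [this]
  clear this
  generalize decide (s 0) = a0
  generalize decide (s 1) = a1
  generalize decide (s 2) = a2
  generalize decide (s 3) = a3
  generalize decide (s 4) = a4
  revert a0 a1 a2 a3 a4 x
  decide +kernel

theorem enc_take (q : ℕ) : ∀ w : Wd, enc (w.take q) = enc w % 8 ^ q := by
  induction q with
  | zero => intro w; simp [enc, Nat.mod_one]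
  | succ q ih =>
    intro w
    cases w with
    | nil => simp [enc]
    | cons x w =>
      have hx := x.isLt
      rw [List.take_succ_cons, enc, ih, enc, pow_succ', Nat.mod_mul]
      have h1 : (8 * enc w + (x.val + 1)) % 8 = x.val + 1 := by omega
      have h2 : (8 * enc w + (x.val + 1)) / 8 = enc w := by omega
      rw [h1, h2]; omega

theorem enc_drop (q : ℕ) : ∀ w : Wd, enc (w.drop q) = enc w / 8 ^ q := by
  induction q with
  | zero => intro w; simp
  | succ q ih =>
    intro w
    cases w with
    | nil => simp [enc]
    | cons x w =>
      have hx := x.isLt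
      rw [List.drop_succ_cons, ih, enc, pow_succ', ← Nat.div_div_eq_div_mul]
      have h2 : (8 * enc w + (x.val + 1)) / 8 = enc w := by omega
      rw [h2]

theorem enc_inj : ∀ w v : Wd, enc w = enc v → w = v := by
  intro w
  induction w with
  | nil => intro v h; cases v with
    | nil => rfl
    | cons y v => simp [enc] at h
  | cons x w ih =>
    intro v h; cases v with
    | nil => simp [enc] at h
    | cons y v =>
      simp only [enc] at h
      have hx := x.isLt
      have hy := y.isLt
      have h1 : enc w = enc v := by omega
      have h2 : x = y := Fin.ext (by omega)
      rw [ih v h1, h2]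

def od : Option (Fin 5) → ℕ
  | none => 0
  | some x => x.val + 1

theorem od_inj : ∀ a b, od a = od b ↔ a = b := by decide

theorem dg_enc (q : ℕ) (w : Wd) : dg (8 ^ q) (enc w) = od w[q]? := by
  change (enc w / 8 ^ q) % 8 = _
  rw [← enc_drop, ← List.head?_drop]
  cases w.drop q with
  | nil => rfl
  | cons x v =>
    have := x.isLt
    simp [enc, od]; omega

theorem bitN_enc (q : ℕ) (w : Wd) : bitN (8 ^ q) (enc w) = MM (fun b => w[q]? = some b) := by
  unfold bitN
  rw [dg_enc]
  generalize w[q]? = o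
  revert o
  decide +kernel

theorem eqN_enc (q r : ℕ) (w : Wd) : eqN (8 ^ q) (8 ^ r) (enc w) = decide (w[q]? = w[r]?) := by
  unfold eqN
  rw [dg_enc, dg_enc]
  generalize w[q]? = o
  generalize w[r]? = o'
  revert o o'
  decide +kernel

instance (p : ℕ) (w : Wd) : Decidable (Sq p w) := by unfold Sq; infer_instance

theorem MM_false : MM (fun _ => False) = 0 := by decide

theorem Sq_cons (q : ℕ) (b : Fin 5) (w : Wd) : Sq (q + 1) (b :: w) ↔
    (w[q]? = some b ∧ w.take q = (w.drop (q+1)).take q) := by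
  unfold Sq
  rw [List.take_succ_cons, List.drop_succ_cons]
  have e : w.drop (q+1) = (w.drop q).tail := by simp
  constructor
  · rintro ⟨h1, h2⟩
    rw [← List.head?_drop, e]
    cases h : w.drop q with
    | nil => rw [h] at h2; simp at h2
    | cons c v =>
      rw [h] at h2
      simp only [List.take_succ_cons, List.cons.injEq] at h2
      simp [h2.1, h2.2]
  · rintro ⟨h1, h2⟩
    have hl := congrArg List.length h2
    have hq : q < w.length := by
      by_contra hh
      rw [List.getElem?_eq_none (by omega)] at h1; simp at h1
    constructor
    · simp at hl ⊢; omega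
    · rw [← List.head?_drop] at h1
      rw [e] at h2
      cases h : w.drop q with
      | nil => rw [h] at h1; simp at h1
      | cons c v =>
        rw [h] at h1 h2
        simp at h1 h2
        simp [h1, h2]

theorem kp_enc (q : ℕ) (w : Wd) : kp (8 ^ q) (enc w) = MM (fun b => Sq (q+1) (b :: w)) := by
  unfold kp
  rw [bitN_enc]
  have h : Nat.beq (Nat.mod (enc w) (8 ^ q)) (Nat.mod (Nat.div (enc w) (Nat.mul (8 ^ q) 8)) (8 ^ q))
      = decide (w.take q = (w.drop (q+1)).take q) := by
    change Nat.beq (enc w % 8 ^ q) (enc w / (8 ^ q * 8) % 8 ^ q) = _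
    rw [← pow_succ, ← enc_drop, ← enc_take, ← enc_take]
    rw [Bool.eq_iff_iff, Nat.beq_eq, decide_eq_true_iff]
    exact ⟨fun h => enc_inj _ _ h, fun h => by rw [h]⟩
  rw [h]
  by_cases hh : w.take q = (w.drop (q+1)).take q
  · rw [decide_eq_true hh, cond_true]
    refine MM_congr fun b => ?_
    rw [Sq_cons]
    exact ⟨fun h => ⟨h, hh⟩, fun h => h.1⟩
  · rw [decide_eq_false hh]
    simp only [cond_false]
    rw [← MM_false]
    refine MM_congr fun b => ?_
    rw [Sq_cons]
    exact ⟨fun h => h.elim, fun h => hh h.2⟩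

instance (w : Wd) : Decidable (Sh w) :=
  decidable_of_iff (¬ (Sq 1 w ∨ Sq 2 w ∨ Sq 3 w ∨ Sq 4 w ∨ Sq 5 w)) (by
    unfold Sh
    constructor
    · intro h p h1 h2 h3
      apply h
      interval_cases p <;> simp [h3]
    · rintro h (h1 | h1 | h1 | h1 | h1)
      · exact h 1 (by omega) (by omega) h1
      · exact h 2 (by omega) (by omega) h1
      · exact h 3 (by omega) (by omega) h1
      · exact h 4 (by omega) (by omega) h1
      · exact h 5 (by omega) (by omega) h1)

theorem Sh_iff (w : Wd) : ¬ Sh w ↔ (Sq 1 w ∨ Sq 2 w ∨ Sq 3 w ∨ Sq 4 w ∨ Sq 5 w) := by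
  unfold Sh
  constructor
  · intro h
    by_contra hh
    apply h
    intro p h1 h2 h3
    apply hh
    interval_cases p <;> simp [h3]
  · rintro (h1 | h1 | h1 | h1 | h1) h
    · exact h 1 (by omega) (by omega) h1
    · exact h 2 (by omega) (by omega) h1
    · exact h 3 (by omega) (by omega) h1
    · exact h 4 (by omega) (by omega) h1
    · exact h 5 (by omega) (by omega) h1

theorem KN_enc (w : Wd) : KN (enc w) = MM (fun b => ¬ Sh (b :: w)) := by
  unfold KN
  have h0 := kp_enc 0 w
  have h1 := kp_enc 1 w
  have h2 := kp_enc 2 w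
  have h3 := kp_enc 3 w
  have h4 := kp_enc 4 w
  norm_num at h0 h1 h2 h3 h4
  rw [h0, h1, h2, h3, h4, MM_lor, MM_lor, MM_lor, MM_lor]
  exact MM_congr fun b => (Sh_iff _).symm

instance : (w : Wd) → Decidable (Ban w)
  | [] => isFalse (by simp [Ban])
  | b :: w => by unfold Ban; infer_instance

theorem cond_MM (p : Prop) [Decidable p] (s : Fin 5 → Prop) [DecidablePred s] :
    cond (decide p) (MM s) 0 = MM (fun b => p ∧ s b) := by
  by_cases h : p
  · simp only [h, decide_true, cond_true, true_and]
  · simp only [h, decide_false, cond_false, false_and, MM_false]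

theorem b1_enc (w : Wd) : b1 (enc w) = MM (fun b =>
    (w[1]? = some b ∧ w[3]? = some b ∧ w[5]? = some b ∧ w[0]? = w[4]?)) := by
  unfold b1
  have e1 := eqN_enc 1 3 w
  have e2 := eqN_enc 3 5 w
  have e3 := eqN_enc 0 4 w
  have e4 := bitN_enc 1 w
  norm_num only at e1 e2 e3 e4
  rw [e1, e2, e3, e4, cond_MM, cond_MM, cond_MM]
  refine MM_congr fun b => ?_
  constructor
  · rintro ⟨h1, h2, h3, h4⟩
    exact ⟨h4, h1 ▸ h4, h2 ▸ h1 ▸ h4, h3⟩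
  · rintro ⟨h1, h2, h3, h4⟩
    exact ⟨h1.trans h2.symm, h2.trans h3.symm, h4, h1⟩

theorem b2_enc (w : Wd) : b2 (enc w) = MM (fun b =>
    (w[1]? = some b ∧ w[4]? = some b ∧ w[6]? = some b ∧ w[0]? = w[5]? ∧ w[2]? = w[7]?)) := by
  unfold b2
  have e1 := eqN_enc 1 4 w
  have e2 := eqN_enc 1 6 w
  have e3 := eqN_enc 0 5 w
  have e4 := eqN_enc 2 7 w
  have e5 := bitN_enc 1 w
  norm_num only at e1 e2 e3 e4 e5
  rw [e1, e2, e3, e4, e5, cond_MM, cond_MM, cond_MM, cond_MM]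
  refine MM_congr fun b => ?_
  constructor
  · rintro ⟨h1, h2, h3, h4, h5⟩
    exact ⟨h5, h1 ▸ h5, h2 ▸ h5, h3, h4⟩
  · rintro ⟨h1, h2, h3, h4, h5⟩
    exact ⟨h1.trans h2.symm, h1.trans h3.symm, h4, h5, h1⟩

theorem b3_enc (w : Wd) : b3 (enc w) = MM (fun b =>
    (w[2]? = some b ∧ w[4]? = some b ∧ w[7]? = some b ∧ w[0]? = w[5]? ∧ w[1]? = w[6]?)) := by
  unfold b3
  have e1 := eqN_enc 2 4 w
  have e2 := eqN_enc 2 7 w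
  have e3 := eqN_enc 0 5 w
  have e4 := eqN_enc 1 6 w
  have e5 := bitN_enc 2 w
  norm_num only at e1 e2 e3 e4 e5
  rw [e1, e2, e3, e4, e5, cond_MM, cond_MM, cond_MM, cond_MM]
  refine MM_congr fun b => ?_
  constructor
  · rintro ⟨h1, h2, h3, h4, h5⟩
    exact ⟨h5, h1 ▸ h5, h2 ▸ h5, h3, h4⟩
  · rintro ⟨h1, h2, h3, h4, h5⟩
    exact ⟨h1.trans h2.symm, h1.trans h3.symm, h4, h5, h1⟩

theorem BN_enc (w : Wd) : BN (enc w) = MM (fun b => Ban (b :: w)) := by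
  unfold BN
  rw [b1_enc, b2_enc, b3_enc, MM_lor, MM_lor]
  exact MM_congr fun b => Iff.rfl

theorem gN_enc (w : Wd) : gN (enc w) = MM (fun b => Sh (b :: w) ∧ ¬ Ban (b :: w)) := by
  unfold gN
  rw [KN_enc, BN_enc, MM_lor, MM_sub]
  exact MM_congr fun b => by tauto

theorem force_eq {α : Type} (n : ℕ) (f : ℕ → α) : force n f = f n := by
  cases n <;> rfl

def G1 (w : Wd) : Finset (Fin 5) := Finset.univ.filter (fun x => Sh (x :: w) ∧ ¬ Ban (x :: w))

def G3 (b : Fin 5) (w : Wd) : Finset (Fin 5 × Fin 5) := Finset.univ.filter (fun p =>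
  Sh (p.1 :: w) ∧ Sh (p.2 :: p.1 :: w) ∧ Sh (b :: p.2 :: p.1 :: w) ∧ ¬ Ban (b :: p.2 :: p.1 :: w))

def QP (w : Wd) : Prop := ¬ Ban w → 3 ≤ (G1 w).card ∧ ∀ b, 8 ≤ (G3 b w).card

theorem stp_enc (w : Wd) (x : Fin 5) (f : ℕ → ℕ) :
    stp (MM (fun b => ¬ Sh (b :: w))) (64 ^ x.val) (x.val + 1) (enc w) f =
      if Sh (x :: w) then f (enc (x :: w)) else 0 := by
  unfold stp
  rw [MM_fr, force_eq]
  by_cases h : Sh (x :: w)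
  · simp only [h, not_true, not_false_iff, decide_true, cond_true, if_true]; rfl
  · simp only [h, not_false_iff, not_true, decide_false, cond_false, if_false]

theorem sumN_enc (w : Wd) (f : ℕ → ℕ) :
    sumN (MM (fun b => ¬ Sh (b :: w))) (enc w) f =
      ∑ x : Fin 5, if Sh (x :: w) then f (enc (x :: w)) else 0 := by
  rw [Fin.sum_univ_five, ← stp_enc, ← stp_enc, ← stp_enc, ← stp_enc, ← stp_enc]
  unfold sumN
  simp only [Nat.add_eq, add_assoc]
  rfl

theorem v2_enc (w : Wd) : v2 (enc w) =
    ∑ y : Fin 5, if Sh (y :: w) then MM (fun b => Sh (b :: y :: w) ∧ ¬ Ban (b :: y :: w)) else 0 := by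
  unfold v2
  rw [force_eq, KN_enc, sumN_enc]
  simp only [gN_enc]

theorem MM_eq (s : Fin 5 → Prop) [DecidablePred s] :
    MM s = ∑ b : Fin 5, 64 ^ b.val * (if s b then 1 else 0) := by
  have : ∀ b, (if s b then 1 else 0) = (decide (s b)).toNat := by
    intro b; by_cases h : s b <;> simp [h]
  simp only [this, Fin.sum_univ_five]
  unfold MM
  norm_num

theorem d3_enc (w : Wd) : sumN (MM (fun b => ¬ Sh (b :: w))) (enc w) v2 =
    ∑ b : Fin 5, 64 ^ b.val * (G3 b w).card := by
  rw [sumN_enc]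
  simp only [v2_enc, MM_eq]
  unfold G3
  simp only [Finset.card_filter, Fintype.sum_prod_type, Finset.mul_sum]
  have : ∀ x : Fin 5, (∑ b : Fin 5, ∑ y : Fin 5, 64 ^ b.val * (if Sh (x :: w) ∧ Sh (y :: x :: w) ∧
      Sh (b :: y :: x :: w) ∧ ¬ Ban (b :: y :: x :: w) then 1 else 0)) = 
      if Sh (x :: w) then ∑ y : Fin 5, (if Sh (y :: x :: w) then ∑ b : Fin 5, 64 ^ b.val *
       (if Sh (b :: y :: x :: w) ∧ ¬ Ban (b :: y :: x :: w) then 1 else 0) else 0) else 0 := by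
    intro x
    by_cases h : Sh (x :: w)
    · simp only [h, true_and, if_true]
      rw [Finset.sum_comm]
      refine Finset.sum_congr rfl fun y _ => ?_
      by_cases h' : Sh (y :: x :: w)
      · simp only [h', true_and, if_true]
      · simp only [h', false_and, if_false, mul_zero, Finset.sum_const_zero]
    · simp only [h, false_and, if_false, mul_zero, Finset.sum_const_zero]
  rw [Finset.sum_comm]
  exact Finset.sum_congr rfl fun x _ => (this x).symm

theorem G3_le (b : Fin 5) (w : Wd) : (G3 b w).card ≤ 25 :=
  (Finset.card_filter_le _ _).trans (by simp)

theorem big_imp (V : ℕ) (h : big V = true) : 8 ≤ V % 64 ∧ 8 ≤ V / 64 % 64 ∧ 8 ≤ V / 4096 % 64 ∧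
    8 ≤ V / 262144 % 64 ∧ 8 ≤ V / 16777216 % 64 := by
  unfold big at h
  simp only [Bool.and_eq_true, Nat.ble_eq] at h
  exact h

theorem QN_enc (w : Wd) (h : QN (KN (enc w)) (enc w) = true) :
    3 ≤ (G1 w).card ∧ ∀ b, 8 ≤ (G3 b w).card := by
  unfold QN at h
  rw [force_eq, KN_enc, d3_enc, gN_enc, MM_mod, Fin.sum_univ_five] at h
  have h0 := G3_le 0 w
  have h1 := G3_le 1 w
  have h2 := G3_le 2 w
  have h3 := G3_le 3 w
  have h4 := G3_le 4 w
  rw [Bool.and_eq_true] at h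
  obtain ⟨ha, hb⟩ := h
  refine ⟨Nat.le_of_ble_eq_true ha, ?_⟩
  replace hb := big_imp _ hb
  norm_num only [Fin.val_zero, Fin.val_one, Fin.val_two, show ((3 : Fin 5).val = 3) from rfl,
    show ((4 : Fin 5).val = 4) from rfl] at hb
  intro b
  fin_cases b
  · change 8 ≤ (G3 0 w).card; omega
  · change 8 ≤ (G3 1 w).card; omega
  · change 8 ≤ (G3 2 w).card; omega
  · change 8 ≤ (G3 3 w).card; omega
  · change 8 ≤ (G3 4 w).card; omega

def Gd : Wd → Prop
  | [] => True
  | x :: w => Sh (x :: w) ∧ Gd w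

theorem Sq_map (σ : Equiv.Perm (Fin 5)) (p : ℕ) (w : Wd) : Sq p (w.map σ) ↔ Sq p w := by
  unfold Sq
  rw [List.length_map, ← List.map_take, ← List.map_drop, ← List.map_take,
    (List.map_injective_iff.2 σ.injective).eq_iff]

theorem Sh_map (σ : Equiv.Perm (Fin 5)) (w : Wd) : Sh (w.map σ) ↔ Sh w := by
  unfold Sh
  simp only [Sq_map]

theorem Ban_map (σ : Equiv.Perm (Fin 5)) (w : Wd) : Ban (w.map σ) ↔ Ban w := by
  cases w with
  | nil => rfl
  | cons b w =>
    have h1 : ∀ i : ℕ, (w.map σ)[i]? = some (σ b) ↔ w[i]? = some b := by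
      intro i
      rw [List.getElem?_map, ← Option.map_some, (Option.map_injective σ.injective).eq_iff]
    have h2 : ∀ i j : ℕ, (w.map σ)[i]? = (w.map σ)[j]? ↔ w[i]? = w[j]? := by
      intro i j
      rw [List.getElem?_map, List.getElem?_map, (Option.map_injective σ.injective).eq_iff]
    rw [List.map_cons]
    simp only [Ban, h1, h2]

theorem Gd_map (σ : Equiv.Perm (Fin 5)) (w : Wd) : Gd (w.map σ) ↔ Gd w := by
  induction w with
  | nil => rfl
  | cons b w ih =>
    have := Sh_map σ (b :: w)
    rw [List.map_cons] at this ⊢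
    simp only [Gd, ih, this]

theorem QP_map (σ : Equiv.Perm (Fin 5)) (w : Wd) (h : QP (w.map σ)) : QP w := by
  intro hb
  obtain ⟨h1, h3⟩ := h (by rwa [Ban_map])
  constructor
  · refine h1.trans (Finset.card_le_card_of_injOn σ.symm ?_ σ.symm.injective.injOn)
    intro x hx
    have e : x :: w.map σ = (σ.symm x :: w).map σ := by simp
    simp only [G1, Finset.coe_filter, Finset.mem_univ, true_and, Set.mem_ofPred_eq] at hx ⊢
    rwa [e, Sh_map, Ban_map] at hx
  · intro b
    refine (h3 (σ b)).trans (Finset.card_le_card_of_injOn (fun p => (σ.symm p.1, σ.symm p.2)) ?_ ?_)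
    · rintro ⟨x, y⟩ hx
      have e1 : x :: w.map σ = (σ.symm x :: w).map σ := by simp
      have e2 : y :: x :: w.map σ = (σ.symm y :: σ.symm x :: w).map σ := by simp
      have e3 : σ b :: y :: x :: w.map σ = (b :: σ.symm y :: σ.symm x :: w).map σ := by simp
      simp only [G3, Finset.coe_filter, Finset.mem_univ, true_and, Set.mem_ofPred_eq] at hx ⊢
      rwa [e3, e2, e1, Sh_map, Sh_map, Sh_map, Ban_map] at hx
    · rintro ⟨x, y⟩ _ ⟨x', y'⟩ _ h
      simpa using h

theorem Gd_append (l w : Wd) (h : Gd (l ++ w)) : Gd w := by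
  induction l with
  | nil => exact h
  | cons x l ih => exact ih h.2

theorem chk_sound (n : ℕ) : ∀ (w : Wd) (c : ℕ) (t : Bool), chkN n (enc w) c t = true →
    (t = true → Ban w) → 1 ≤ c → (∀ x ∈ w, x.val + 1 < c) → ∀ l : Wd, l.length ≤ n →
    Gd (l.reverse ++ w) → QP (l.reverse ++ w) := by
  induction n with
  | zero =>
    intro w c t h ht _ _ l hl _
    have : l = [] := List.length_eq_zero_iff.1 (by omega)
    subst this
    intro hb
    unfold chkN at h
    cases t with
    | true => exact absurd (ht rfl) hb
    | false => exact QN_enc w (by simpa using h)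
  | succ n ih =>
    intro w c t h ht hc hw l hl hg
    unfold chkN at h
    rw [force_eq, Bool.and_eq_true] at h
    obtain ⟨ha, hb⟩ := h
    rw [force_eq, List.all_eq_true] at hb
    cases l with
    | nil =>
      intro hban
      cases t with
      | true => exact absurd (ht rfl) hban
      | false => exact QN_enc w (by simpa using ha)
    | cons x l =>
      have hl' : l.length ≤ n := by simpa using hl
      have key : ∀ (x : Fin 5) (l : Wd), l.length ≤ n → x.val + 1 ≤ c →
          Gd (l.reverse ++ x :: w) → QP (l.reverse ++ x :: w) := by
        intro x l hl hx hg
        have hs : Sh (x :: w) := (Gd_append _ _ hg).1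
        have hm : (64 ^ x.val, x.val + 1) ∈ [(1,1),(64,2),(4096,3),(262144,4),(16777216,5)] := by
          fin_cases x <;> simp
        have h2 := hb _ hm
        simp only [force_eq] at h2
        rw [KN_enc, BN_enc, MM_fr, MM_fr] at h2
        have h3 : Nat.ble (x.val + 1) c = true := Nat.ble_eq_true_of_le hx
        simp only [h3, hs, not_true, not_false_iff, decide_true, Bool.not_true, Bool.false_or] at h2
        refine ih (x :: w) _ _ h2 ?_ ?_ ?_ l hl hg
        · intro hh
          simpa using hh
        · cases Nat.beq (x.val + 1) c
          · exact hc
          · exact Nat.succ_le_succ (Nat.zero_le _)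
        · cases he : Nat.beq (x.val + 1) c with
          | false =>
            have : x.val + 1 ≠ c := Nat.ne_of_beq_eq_false he
            simp only [cond_false]
            intro z hz
            rcases List.mem_cons.1 hz with rfl | hz
            · omega
            · exact hw z hz
          | true =>
            have : x.val + 1 = c := Nat.eq_of_beq_eq_true he
            simp only [cond_true]
            intro z hz
            rcases List.mem_cons.1 hz with rfl | hz
            · omega
            · have := hw z hz; omega
      have el : (x :: l).reverse ++ w = l.reverse ++ x :: w := by simp
      rw [el] at hg ⊢
      by_cases hx : x.val + 1 ≤ c
      · exact key x l hl' hx hg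
      · have hc5 : c - 1 < 5 := by have := x.isLt; omega
        let y : Fin 5 := ⟨c - 1, hc5⟩
        have hwm : w.map (Equiv.swap x y) = w := by
          conv_rhs => rw [← List.map_id w]
          refine List.map_congr_left fun z hz => ?_
          have hz' := hw z hz
          refine Equiv.swap_apply_of_ne_of_ne ?_ ?_
          · rintro rfl; omega
          · intro e
            have : z.val = c - 1 := by rw [e]
            omega
        have em : (l.reverse ++ x :: w).map (Equiv.swap x y) =
            (l.map (Equiv.swap x y)).reverse ++ y :: w := by
          rw [List.map_append, List.map_cons, hwm, Equiv.swap_apply_left, List.map_reverse]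
        apply QP_map (Equiv.swap x y)
        rw [em]
        refine key y _ (by simpa using hl') (by change c - 1 + 1 ≤ c; omega) ?_
        rw [← em, Gd_map]
        exact hg

theorem Sq_take (p m : ℕ) (w : Wd) (h : 2 * p ≤ m) : Sq p (w.take m) ↔ Sq p w := by
  unfold Sq
  rw [List.length_take, List.take_take, List.drop_take, List.take_take,
    min_eq_left (by omega : p ≤ m), min_eq_left (by omega : p ≤ m - p)]
  constructor
  · rintro ⟨a, b⟩; exact ⟨by omega, b⟩
  · rintro ⟨a, b⟩; exact ⟨by omega, b⟩

theorem Sh_take (m : ℕ) (w : Wd) (h : 10 ≤ m) : Sh (w.take m) ↔ Sh w := by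
  unfold Sh
  refine forall_congr' fun p => forall_congr' fun h1 => forall_congr' fun h2 => ?_
  rw [Sq_take p m w (by omega)]

theorem Ban_take (m : ℕ) (w : Wd) (h : 9 ≤ m) : Ban (w.take m) ↔ Ban w := by
  cases w with
  | nil => simp
  | cons b w =>
    obtain ⟨m, rfl⟩ : ∃ k, m = k + 9 := ⟨m - 9, by omega⟩
    have : ∀ i : ℕ, i < 8 → (w.take (m + 8))[i]? = w[i]? := by
      intro i hi
      exact List.getElem?_take_of_lt (by omega)
    rw [List.take_succ_cons]
    simp (disch := omega) only [Ban, this]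

theorem Gd_take (w : Wd) : ∀ m : ℕ, Gd w → Gd (w.take m) := by
  induction w with
  | nil => intro m h; simpa using h
  | cons x w ih =>
    intro m h
    cases m with
    | zero => simp [Gd]
    | succ m =>
      refine ⟨?_, ih m h.2⟩
      intro p h1 h2 h3
      rw [← List.take_succ_cons] at h3
      by_cases hp : 2 * p ≤ m + 1
      · exact h.1 p h1 h2 ((Sq_take _ _ _ hp).1 h3)
      · have := h3.1
        rw [List.length_take] at this
        omega

set_option maxRecDepth 100000 in
theorem chk9 : chkN 9 (enc []) 1 false = true := by decide +kernel

theorem QP_of_Gd (w : Wd) (h : Gd w) (hb : ¬ Ban w) :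
    3 ≤ (G1 w).card ∧ ∀ b, 8 ≤ (G3 b w).card := by
  have h1 := chk_sound 9 [] 1 false chk9 (by simp) le_rfl (by simp) (w.take 9).reverse
    (by simp) (by simpa using Gd_take w 9 h)
  simp only [List.reverse_reverse, List.append_nil] at h1
  obtain ⟨h2, h3⟩ := h1 (by rwa [Ban_take _ _ le_rfl])
  have e1 : ∀ x, x :: w.take 9 = (x :: w).take 10 := fun x => rfl
  have e2 : ∀ y x, y :: x :: w.take 9 = (y :: x :: w).take 11 := fun y x => rfl
  have e3 : ∀ b y x, b :: y :: x :: w.take 9 = (b :: y :: x :: w).take 12 := fun b y x => rfl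
  constructor
  · have : G1 (w.take 9) = G1 w := by
      unfold G1
      refine Finset.filter_congr fun x _ => ?_
      rw [e1, Sh_take _ _ (by omega), Ban_take _ _ (by omega)]
    rwa [this] at h2
  · intro b
    have : G3 b (w.take 9) = G3 b w := by
      unfold G3
      refine Finset.filter_congr fun x _ => ?_
      rw [e3, e2, e1, Sh_take _ _ (by omega), Sh_take _ _ (by omega), Sh_take _ _ (by omega),
        Ban_take _ _ (by omega)]
    rw [← this]
    exact h3 b

def RR (S : Finset Wd) (d : ℕ) : ℕ := (S.image (List.drop d)).card

def tau (n : ℕ) (S : Finset Wd) (j : ℕ) : ℕ := ∑ d ∈ Finset.Ico j (n + 1), RR S d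

def NL (w : Wd) : Prop := ∀ p, 6 ≤ p → ¬ Sq p w

theorem key_count (n e : ℕ) (S Z : Finset Wd) (hS : ∀ w ∈ S, w.length = n) (he : e ≤ 5)
    (hZ : ∀ z ∈ Z, z.drop e ∈ S ∧ ¬ NL z) : Z.card ≤ tau n S (6 - e) := by
  have hsub : Z ⊆ (Finset.Ico (6 - e) (n + 1)).biUnion (fun d =>
      (S.image (List.drop d)).image (fun v => v.take (d + e) ++ v)) := by
    intro z hz
    obtain ⟨h1, h2⟩ := hZ z hz
    unfold NL at h2
    push Not at h2
    obtain ⟨p, hp, hsq⟩ := h2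
    have hl := hS _ h1
    rw [List.length_drop] at hl
    have hl2 := hsq.1
    rw [Finset.mem_biUnion]
    refine ⟨p - e, Finset.mem_Ico.2 ⟨by omega, by omega⟩, ?_⟩
    rw [Finset.mem_image]
    refine ⟨z.drop p, ?_, ?_⟩
    · rw [Finset.mem_image]
      refine ⟨_, h1, ?_⟩
      rw [List.drop_drop]
      congr 1; omega
    · rw [show p - e + e = p by omega, ← hsq.2, List.take_append_drop]
  refine (Finset.card_le_card hsub).trans (Finset.card_biUnion_le.trans ?_)
  exact Finset.sum_le_sum fun d _ => Finset.card_image_le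

theorem tau_step (n e j : ℕ) (S S' : Finset Wd) (h : ∀ z ∈ S', z.drop e ∈ S) :
    tau (n + e) S' (j + e) ≤ tau n S j := by
  unfold tau
  rw [show n + e + 1 = (n + 1) + e by omega, ← Finset.sum_Ico_add']
  refine Finset.sum_le_sum fun d _ => Finset.card_le_card ?_
  intro v hv
  rw [Finset.mem_image] at hv ⊢
  obtain ⟨z, hz, rfl⟩ := hv
  exact ⟨_, h z hz, by rw [List.drop_drop]; congr 1; omega⟩

theorem tau_head (n j : ℕ) (S : Finset Wd) : tau n S j ≤ S.card + tau n S (j + 1) := by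
  unfold tau
  by_cases h : j < n + 1
  · rw [Finset.sum_eq_sum_Ico_succ_bot h]
    exact Nat.add_le_add_right Finset.card_image_le _
  · rw [Finset.Ico_eq_empty (by omega)]; simp

def SFw : Wd → Prop
  | [] => True
  | x :: w => (∀ p, 1 ≤ p → ¬ Sq p (x :: w)) ∧ SFw w

theorem SFw_Gd (w : Wd) (h : SFw w) : Gd w := by
  induction w with
  | nil => trivial
  | cons x w ih => exact ⟨fun p h1 _ => h.1 p h1, ih h.2⟩

theorem SFw_cons (x : Fin 5) (w : Wd) (h : SFw w) (h1 : Sh (x :: w)) (h2 : NL (x :: w)) :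
    SFw (x :: w) := by
  refine ⟨fun p hp => ?_, h⟩
  by_cases h5 : p ≤ 5
  · exact h1 p hp h5
  · exact h2 p (by omega)

def Mt (fx : ℕ → Option (Fin 5)) : Wd → Prop
  | [] => True
  | x :: w => (∀ b, fx w.length = some b → x = b) ∧ Mt fx w

structure StageInv (fx : ℕ → Option (Fin 5)) (n : ℕ) (S : Finset Wd) : Prop where
  len : ∀ w ∈ S, w.length = n
  sf : ∀ w ∈ S, SFw w
  ban : ∀ w ∈ S, ¬ Ban w
  mt : ∀ w ∈ S, Mt fx w
  pos : 0 < S.card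
  t0 : 20 * tau n S 0 ≤ 75 * S.card
  t1 : 20 * tau n S 1 ≤ 55 * S.card
  t2 : 20 * tau n S 2 ≤ 35 * S.card
  t3 : 20 * tau n S 3 ≤ 15 * S.card
  t4 : 20 * tau n S 4 ≤ 11 * S.card
  t5 : 20 * tau n S 5 ≤ 7 * S.card

theorem StageInv_zero (fx : ℕ → Option (Fin 5)) : StageInv fx 0 {[]} := by
  constructor <;> simp [SFw, Ban, Mt, tau, RR]

theorem step1 (fx : ℕ → Option (Fin 5)) (n : ℕ) (S : Finset Wd) (h : StageInv fx n S)
    (h0 : fx n = none) : ∃ S', StageInv fx (n + 1) S' := by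
  classical
  let C : Finset Wd := (S.sigma G1).image (fun s => s.2 :: s.1)
  have hC : 3 * S.card ≤ C.card := by
    have : C.card = ∑ w ∈ S, (G1 w).card := by
      rw [Finset.card_image_of_injOn, Finset.card_sigma]
      rintro ⟨w, x⟩ _ ⟨w', x'⟩ _ hh
      simp only [List.cons.injEq] at hh
      obtain ⟨rfl, rfl⟩ := hh
      rfl
    rw [this, mul_comm, ← smul_eq_mul, ← Finset.sum_const]
    exact Finset.sum_le_sum fun w hw => (QP_of_Gd w (SFw_Gd w (h.sf w hw)) (h.ban w hw)).1
  have mC : ∀ z ∈ C, ∃ x w, z = x :: w ∧ w ∈ S ∧ Sh (x :: w) ∧ ¬ Ban (x :: w) := by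
    intro z hz
    obtain ⟨⟨w, x⟩, hs, rfl⟩ := Finset.mem_image.1 hz
    obtain ⟨h1, h2⟩ := Finset.mem_sigma.1 hs
    have h3 := (Finset.mem_filter.1 h2).2
    exact ⟨x, w, rfl, h1, h3.1, h3.2⟩
  have hd : ∀ z ∈ C, z.drop 1 ∈ S := by
    intro z hz
    obtain ⟨x, w, rfl, hw, _⟩ := mC z hz
    exact hw
  have hbad : (C.filter (fun z => ¬ NL z)).card ≤ tau n S 5 :=
    key_count n 1 S _ h.len (by omega) fun z hz =>
      ⟨hd z (Finset.mem_filter.1 hz).1, (Finset.mem_filter.1 hz).2⟩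
  have hsum := Finset.card_filter_add_card_filter_not (s := C) (fun z => NL z)
  set S' := C.filter (fun z => NL z) with hS'
  have hd' : ∀ z ∈ S', z.drop 1 ∈ S := fun z hz => hd z (Finset.mem_filter.1 hz).1
  have a0 := tau_head (n + 1) 0 S'
  have a1 := tau_step n 1 0 S S' hd'
  have a2 := tau_step n 1 1 S S' hd'
  have a3 := tau_step n 1 2 S S' hd'
  have a4 := tau_step n 1 3 S S' hd'
  have a5 := tau_step n 1 4 S S' hd'
  norm_num only at a0 a1 a2 a3 a4 a5
  have i0 := h.t0
  have i1 := h.t1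
  have i2 := h.t2
  have i3 := h.t3
  have i4 := h.t4
  have i5 := h.t5
  have ip := h.pos
  have hgrow : 53 * S.card ≤ 20 * S'.card := by omega
  refine ⟨S', ?_, ?_, ?_, ?_, by omega, by omega, by omega, by omega, by omega, by omega, by omega⟩
  · intro z hz
    obtain ⟨x, w, rfl, hw, _⟩ := mC z (Finset.mem_filter.1 hz).1
    simp [h.len w hw]
  · intro z hz
    have hnl := (Finset.mem_filter.1 hz).2
    obtain ⟨x, w, rfl, hw, hsh, _⟩ := mC z (Finset.mem_filter.1 hz).1
    exact SFw_cons x w (h.sf w hw) hsh hnl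
  · intro z hz
    obtain ⟨x, w, rfl, hw, hsh, hb⟩ := mC z (Finset.mem_filter.1 hz).1
    exact hb
  · intro z hz
    obtain ⟨x, w, rfl, hw, hsh, hb⟩ := mC z (Finset.mem_filter.1 hz).1
    refine ⟨?_, h.mt w hw⟩
    rw [h.len w hw, h0]
    simp

theorem Sh_ne (x y : Fin 5) (w : Wd) (h : Sh (y :: x :: w)) : y ≠ x := by
  rintro rfl
  refine h 1 le_rfl (by omega) ⟨by simp, by simp⟩

theorem step3 (fx : ℕ → Option (Fin 5)) (n : ℕ) (S : Finset Wd) (b : Fin 5) (h : StageInv fx n S)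
    (h0 : fx n = none) (h1 : fx (n + 1) = none) (h2 : fx (n + 2) = some b) :
    ∃ S', StageInv fx (n + 3) S' := by
  classical
  let C : Finset Wd := (S.sigma (G3 b)).image (fun s => b :: s.2.2 :: s.2.1 :: s.1)
  have hC : 8 * S.card ≤ C.card := by
    have : C.card = ∑ w ∈ S, (G3 b w).card := by
      rw [Finset.card_image_of_injOn, Finset.card_sigma]
      rintro ⟨w, x, y⟩ _ ⟨w', x', y'⟩ _ hh
      simp only [List.cons.injEq, true_and] at hh
      obtain ⟨rfl, rfl, rfl⟩ := hh
      rfl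
    rw [this, mul_comm, ← smul_eq_mul, ← Finset.sum_const]
    exact Finset.sum_le_sum fun w hw => (QP_of_Gd w (SFw_Gd w (h.sf w hw)) (h.ban w hw)).2 b
  have mC : ∀ z ∈ C, ∃ x y w, z = b :: y :: x :: w ∧ w ∈ S ∧ Sh (x :: w) ∧ Sh (y :: x :: w) ∧
      Sh (b :: y :: x :: w) ∧ ¬ Ban (b :: y :: x :: w) := by
    intro z hz
    obtain ⟨⟨w, x, y⟩, hs, rfl⟩ := Finset.mem_image.1 hz
    obtain ⟨h1, h2⟩ := Finset.mem_sigma.1 hs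
    have h3 := (Finset.mem_filter.1 h2).2
    exact ⟨x, y, w, rfl, h1, h3⟩
  have hd : ∀ z ∈ C, z.drop 3 ∈ S := by
    intro z hz
    obtain ⟨x, y, w, rfl, hw, _⟩ := mC z hz
    exact hw
  have hb0 : (C.filter (fun z => ¬ NL z)).card ≤ tau n S 3 :=
    key_count n 3 S _ h.len (by omega) fun z hz =>
      ⟨hd z (Finset.mem_filter.1 hz).1, (Finset.mem_filter.1 hz).2⟩
  have hb1 : (C.filter (fun z => ¬ NL z.tail)).card ≤ tau n S 4 := by
    rw [← Finset.card_image_of_injOn (f := List.tail)]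
    · refine key_count n 2 S _ h.len (by omega) ?_
      intro v hv
      obtain ⟨z, hz, rfl⟩ := Finset.mem_image.1 hv
      refine ⟨?_, (Finset.mem_filter.1 hz).2⟩
      obtain ⟨x, y, w, rfl, hw, _⟩ := mC z (Finset.mem_filter.1 hz).1
      exact hw
    · intro z hz z' hz' hh
      obtain ⟨x, y, w, rfl, hw, _⟩ := mC z (Finset.mem_filter.1 hz).1
      obtain ⟨x', y', w', rfl, hw', _⟩ := mC z' (Finset.mem_filter.1 hz').1
      simpa using hh
  have hb2 : (C.filter (fun z => ¬ NL (z.drop 2))).card ≤ 4 * tau n S 5 := by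
    set Z := C.filter (fun z => ¬ NL (z.drop 2)) with hZ
    have e1 : (Z.image (List.drop 2)).card ≤ tau n S 5 := by
      refine key_count n 1 S _ h.len (by omega) ?_
      intro v hv
      obtain ⟨z, hz, rfl⟩ := Finset.mem_image.1 hv
      refine ⟨?_, (Finset.mem_filter.1 hz).2⟩
      obtain ⟨x, y, w, rfl, hw, _⟩ := mC z (Finset.mem_filter.1 hz).1
      exact hw
    refine (Finset.card_le_mul_card_image (f := List.drop 2) Z 4 ?_).trans
      (Nat.mul_le_mul_left 4 e1)
    intro v hv
    obtain ⟨z, hz, rfl⟩ := Finset.mem_image.1 hv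
    obtain ⟨x, y, w, rfl, hw, _⟩ := mC z (Finset.mem_filter.1 hz).1
    have : (Finset.univ.erase x).card = 4 := by
      rw [Finset.card_erase_of_mem (Finset.mem_univ _)]; simp
    rw [← this]
    refine (Finset.card_le_card ?_).trans
      (Finset.card_image_le (s := Finset.univ.erase x) (f := fun y => b :: y :: x :: w))
    intro z' hz'
    obtain ⟨hz1, hz2⟩ := Finset.mem_filter.1 hz'
    obtain ⟨x', y', w', rfl, hw', _, hsh, _⟩ := mC z' (Finset.mem_filter.1 hz1).1
    simp only [List.drop_succ_cons, List.drop_zero, List.cons.injEq] at hz2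
    obtain ⟨rfl, rfl⟩ := hz2
    exact Finset.mem_image.2 ⟨y', Finset.mem_erase.2 ⟨Sh_ne _ _ _ hsh, Finset.mem_univ _⟩, rfl⟩
  set S' := C.filter (fun z => NL z ∧ NL z.tail ∧ NL (z.drop 2)) with hS'
  have hsum : C.card ≤ S'.card + ((C.filter (fun z => ¬ NL z)).card +
      ((C.filter (fun z => ¬ NL z.tail)).card + (C.filter (fun z => ¬ NL (z.drop 2))).card)) := by
    have hsub : C ⊆ S' ∪ (C.filter (fun z => ¬ NL z) ∪ (C.filter (fun z => ¬ NL z.tail) ∪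
        C.filter (fun z => ¬ NL (z.drop 2)))) := by
      intro z hz
      simp only [hS', Finset.mem_union, Finset.mem_filter, hz, true_and]
      tauto
    refine (Finset.card_le_card hsub).trans ((Finset.card_union_le _ _).trans ?_)
    refine Nat.add_le_add_left ((Finset.card_union_le _ _).trans ?_) _
    exact Nat.add_le_add_left (Finset.card_union_le _ _) _
  have hd' : ∀ z ∈ S', z.drop 3 ∈ S := fun z hz => hd z (Finset.mem_filter.1 hz).1
  have a0 := tau_head (n + 3) 0 S'
  have a1 := tau_head (n + 3) 1 S'
  have a2 := tau_head (n + 3) 2 S'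
  have a3 := tau_step n 3 0 S S' hd'
  have a4 := tau_step n 3 1 S S' hd'
  have a5 := tau_step n 3 2 S S' hd'
  norm_num only at a0 a1 a2 a3 a4 a5
  have i0 := h.t0
  have i1 := h.t1
  have i2 := h.t2
  have i3 := h.t3
  have i4 := h.t4
  have i5 := h.t5
  have ip := h.pos
  have hgrow : 106 * S.card ≤ 20 * S'.card := by omega
  refine ⟨S', ?_, ?_, ?_, ?_, by omega, by omega, by omega, by omega, by omega, by omega, by omega⟩
  · intro z hz
    obtain ⟨x, y, w, rfl, hw, _⟩ := mC z (Finset.mem_filter.1 hz).1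
    simp [h.len w hw]
  · intro z hz
    have hnl := (Finset.mem_filter.1 hz).2
    obtain ⟨x, y, w, rfl, hw, s1, s2, s3, _⟩ := mC z (Finset.mem_filter.1 hz).1
    exact SFw_cons _ _ (SFw_cons _ _ (SFw_cons x w (h.sf w hw) s1 hnl.2.2) s2 hnl.2.1) s3 hnl.1
  · intro z hz
    obtain ⟨x, y, w, rfl, hw, s1, s2, s3, hb⟩ := mC z (Finset.mem_filter.1 hz).1
    exact hb
  · intro z hz
    obtain ⟨x, y, w, rfl, hw, s1, s2, s3, hb⟩ := mC z (Finset.mem_filter.1 hz).1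
    refine ⟨?_, ?_, ?_, h.mt w hw⟩
    · simp only [List.length_cons, h.len w hw, h2]
      simp
    · simp only [List.length_cons, h.len w hw, h1]
      simp
    · rw [h.len w hw, h0]
      simp

theorem exists_words (fx : ℕ → Option (Fin 5)) (f0 : fx 0 = none) (f1 : fx 1 = none)
    (hf : ∀ t b, fx t = some b → fx (t + 1) = none ∧ fx (t + 2) = none) (k : ℕ) :
    ∃ n S, k ≤ n ∧ StageInv fx n S ∧ fx n = none ∧ fx (n + 1) = none := by
  induction k with
  | zero => exact ⟨0, _, le_rfl, StageInv_zero fx, f0, f1⟩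
  | succ k ih =>
    obtain ⟨n, S, hk, hI, h0, h1⟩ := ih
    cases h2 : fx (n + 2) with
    | none =>
      obtain ⟨S', hS'⟩ := step1 fx n S hI h0
      exact ⟨n + 1, S', by omega, hS', h1, h2⟩
    | some b =>
      obtain ⟨S', hS'⟩ := step3 fx n S b hI h0 h1 h2
      obtain ⟨h3, h4⟩ := hf _ _ h2
      exact ⟨n + 3, S', by omega, hS', h3, h4⟩

theorem SFw_drop (w : Wd) : ∀ m : ℕ, SFw w → ∀ p, 1 ≤ p → ¬ Sq p (w.drop m) := by
  induction w with
  | nil =>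
    intro m _ p hp h
    have := h.1
    simp at this
    omega
  | cons x w ih =>
    intro m h p hp
    cases m with
    | zero => exact h.1 p hp
    | succ m => exact ih m h.2 p hp

theorem Mt_get (fx : ℕ → Option (Fin 5)) (w : Wd) (h : Mt fx w) : ∀ t b, t < w.length →
    fx t = some b → w.reverse[t]? = some b := by
  induction w with
  | nil => intro t b ht; simp at ht
  | cons x w ih =>
    intro t b ht hb
    rw [List.reverse_cons]
    by_cases hh : t < w.length
    · rw [List.getElem?_append_left (by simpa using hh)]
      exact ih h.2 t b hh hb
    · have : t = w.length := by simp at ht; omega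
      subst this
      rw [h.1 b hb]
      simp

theorem word_fun (fx : ℕ → Option (Fin 5)) (w : Wd) (hs : SFw w) (hm : Mt fx w) :
    ∃ u : ℕ → Fin 5, (∀ i n, 1 ≤ n → i + 2 * n ≤ w.length → ∃ j < n, u (i + j) ≠ u (i + n + j)) ∧
      ∀ t b, t < w.length → fx t = some b → u t = b := by
  refine ⟨fun t => (w.reverse[t]?).getD 0, ?_, ?_⟩
  · intro i n hn hl
    by_contra hc
    push Not at hc
    refine SFw_drop w (w.length - (i + 2 * n)) hs n hn ⟨?_, ?_⟩
    · rw [List.length_drop]; omega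
    · apply List.ext_getElem?
      intro m
      by_cases hmn : m < n
      · rw [List.getElem?_take_of_lt hmn, List.getElem?_take_of_lt hmn, List.drop_drop,
          List.getElem?_drop, List.getElem?_drop]
        have h1 := hc (n - 1 - m) (by omega)
        rw [List.getElem?_reverse (by omega), List.getElem?_reverse (by omega)] at h1
        rw [List.getElem?_eq_getElem (by omega), List.getElem?_eq_getElem (by omega)] at h1 ⊢
        simp only [Option.getD_some] at h1
        congr 1
        symm
        convert h1 using 2 <;> omega
      · rw [List.getElem?_take_eq_none (by omega), List.getElem?_take_eq_none (by omega)]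
  · intro t b ht hb
    simp only [Mt_get fx w hm t b ht hb, Option.getD_some]

theorem main_fx (fx : ℕ → Option (Fin 5)) (f0 : fx 0 = none) (f1 : fx 1 = none)
    (hf : ∀ t b, fx t = some b → fx (t + 1) = none ∧ fx (t + 2) = none) :
    ∃ u : ℕ → Fin 5, (∀ i n, 1 ≤ n → ∃ j < n, u (i + j) ≠ u (i + n + j)) ∧
      ∀ t b, fx t = some b → u t = b := by
  let K : ℕ → Set (ℕ → Fin 5) := fun k => {u | (∀ i n, 1 ≤ n → i + 2 * n ≤ k →
    ∃ j < n, u (i + j) ≠ u (i + n + j)) ∧ ∀ t b, t < k → fx t = some b → u t = b}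
  have hne : ∀ k, (K k).Nonempty := by
    intro k
    obtain ⟨n, S, hk, hI, _⟩ := exists_words fx f0 f1 hf k
    obtain ⟨w, hw⟩ := Finset.card_pos.1 hI.pos
    obtain ⟨u, h1, h2⟩ := word_fun fx w (hI.sf w hw) (hI.mt w hw)
    have hl := hI.len w hw
    exact ⟨u, fun i n hn hh => h1 i n hn (by omega), fun t b ht hb => h2 t b (by omega) hb⟩
  have hcl : ∀ k, IsClosed (K k) := by
    intro k
    have e : K k = (⋂ i, ⋂ n, ⋂ (_ : 1 ≤ n), ⋂ (_ : i + 2 * n ≤ k),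
        ⋃ j ∈ Finset.range n, {u : ℕ → Fin 5 | u (i + j) ≠ u (i + n + j)}) ∩
        ⋂ t, ⋂ b, ⋂ (_ : t < k), ⋂ (_ : fx t = some b), {u : ℕ → Fin 5 | u t = b} := by
      ext u
      simp [K]
    rw [e]
    refine IsClosed.inter ?_ ?_
    · refine isClosed_iInter fun i => isClosed_iInter fun n => isClosed_iInter fun _ =>
        isClosed_iInter fun _ => ?_
      refine isClosed_biUnion_finset fun j _ => ?_
      exact (isClosed_discrete {p : Fin 5 × Fin 5 | p.1 ≠ p.2}).preimage
        (f := fun u : ℕ → Fin 5 => (u (i + j), u (i + n + j))) (by fun_prop)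
    · refine isClosed_iInter fun t => isClosed_iInter fun b => isClosed_iInter fun _ =>
        isClosed_iInter fun _ => ?_
      exact (isClosed_discrete {b}).preimage (f := fun u : ℕ → Fin 5 => u t) (by fun_prop)
  obtain ⟨u, hu⟩ := IsCompact.nonempty_iInter_of_sequence_nonempty_isCompact_isClosed K
    (fun k u hu => ⟨fun i n hn hh => hu.1 i n hn (by omega), fun t b ht hb => hu.2 t b (by omega) hb⟩)
    hne (hcl 0).isCompact hcl
  rw [Set.mem_iInter] at hu
  exact ⟨u, fun i n hn => (hu (i + 2 * n)).1 i n hn le_rfl,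
    fun t b hb => (hu (t + 1)).2 t b (by omega) hb⟩

theorem d_five_letters_le_3 :
    ∀ v : ℕ → Fin 5, ∀ q : ℕ → ℕ, 1 ≤ q 1 →
      (∀ i : ℕ, 1 ≤ i → q i + 3 ≤ q (i + 1)) →
      ∃ u : ℕ → Fin 5, SqFreeSeq u ∧ ∀ i : ℕ, 1 ≤ i → u (q i) = v i := by
  classical
  intro v q hq1 hq
  have hadd : ∀ i d : ℕ, 1 ≤ i → q i + 3 * d ≤ q (i + d) := by
    intro i d hi
    induction d with
    | zero => simp
    | succ d ih =>
      have := hq (i + d) (by omega)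
      rw [← add_assoc]
      omega
  have hlt : ∀ i j : ℕ, 1 ≤ i → i < j → q i + 3 ≤ q j := by
    intro i j hi hij
    have := hadd i (j - i) hi
    rw [show i + (j - i) = j by omega] at this
    omega
  have hpos : ∀ i : ℕ, 1 ≤ i → 1 ≤ q i := by
    intro i hi
    have := hadd 1 (i - 1) le_rfl
    rw [show 1 + (i - 1) = i by omega] at this
    omega
  let fx : ℕ → Option (Fin 5) := fun t =>
    if h : ∃ i, 1 ≤ i ∧ q i + 2 = t then some (v h.choose) else none
  have hnone : ∀ t, (∀ i, 1 ≤ i → q i + 2 ≠ t) → fx t = none := by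
    intro t ht
    simp only [fx]
    rw [dif_neg]
    rintro ⟨i, hi, he⟩
    exact ht i hi he
  have hsome : ∀ i, 1 ≤ i → fx (q i + 2) = some (v i) := by
    intro i hi
    have hex : ∃ j, 1 ≤ j ∧ q j + 2 = q i + 2 := ⟨i, hi, rfl⟩
    have hd : fx (q i + 2) = some (v hex.choose) := dif_pos hex
    rw [hd]
    obtain ⟨h1, h2⟩ := hex.choose_spec
    have : hex.choose = i := by
      rcases lt_trichotomy hex.choose i with h | h | h
      · have := hlt _ _ h1 h; omega
      · exact h
      · have := hlt _ _ hi h; omega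
    rw [this]
  have hinv : ∀ t b, fx t = some b → ∃ i, 1 ≤ i ∧ q i + 2 = t := by
    intro t b ht
    by_contra hc
    push Not at hc
    rw [hnone t hc] at ht
    simp at ht
  obtain ⟨u, h1, h2⟩ := main_fx fx (hnone 0 fun i hi => by omega)
    (hnone 1 fun i hi => by have := hpos i hi; omega) (by
      intro t b ht
      obtain ⟨i, hi, rfl⟩ := hinv t b ht
      have hno : ∀ j, 1 ≤ j → q j = q i ∨ q j + 3 ≤ q i ∨ q i + 3 ≤ q j := by
        intro j hj
        rcases lt_trichotomy j i with h | h | h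
        · exact Or.inr (Or.inl (hlt _ _ hj h))
        · exact Or.inl (by rw [h])
        · exact Or.inr (Or.inr (hlt _ _ hi h))
      exact ⟨hnone _ fun j hj => by have := hno j hj; omega,
        hnone _ fun j hj => by have := hno j hj; omega⟩)
  refine ⟨fun t => u (t + 2), ?_, ?_⟩
  · intro i n _ hn
    obtain ⟨j, hj, hne⟩ := h1 (i + 2) n hn
    refine ⟨j, hj, ?_⟩
    change u (i + j + 2) ≠ u (i + n + j + 2)
    rw [show i + j + 2 = i + 2 + j by omega, show i + n + j + 2 = i + 2 + n + j by omega]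
    exact hne
  · intro i hi
    exact h2 _ _ (hsome i hi)
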